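/- arXiv:1612.00242 — 3 statements merged into one kernel-verified Lean document; each statement's English description precedes it below -/
import Mathlib

section
/- Let ℓ ≥ 1 be odd, let W = x y^{α(1)} x y^{α(2)} ⋯ x y^{α(ℓ)} with each α(i) ∈ {1,2} and α(1)+⋯+α(ℓ) ≢ 0 (mod 3), and let G = ⟨x,y | x² = y³ = W² = 1⟩. If G contains no subgroup isomorphic to the free group of rank 2, then ℓ ≤ 49. -/
/-- The free product `ℤ/2 * ℤ/3` is realised as a quotient of the free group on two
generators; here we work with the free group `F` on generators `x, y` and impose the
relations `x² = y³ = W² = 1` all at once via `PresentedGroup`. -/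
abbrev F : Type := FreeGroup (Fin 2)

/-- The generator `x` (of order 2 in the quotient). -/
def x : F := FreeGroup.of 0

/-- The generator `y` (of order 3 in the quotient). -/
def y : F := FreeGroup.of 1

/-- The relators of the generalised triangle group of type (2,3,2) with word `W`. -/
def rels (W : F) : Set F := {x ^ 2, y ^ 3, W ^ 2}

/-- The generalised triangle group `⟨x, y | x² = y³ = W² = 1⟩`. -/
abbrev GT (W : F) : Type := PresentedGroup (rels W)

/-- The canonical projection from the free group to the generalised triangle group. -/
def mk (W : F) : F →* GT W := PresentedGroup.mk (rels W)

section

open Polynomial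

/-- The standard symplectic form on `ℂ²`. -/
def wedge (u v : Fin 2 → ℂ) : ℂ := u 0 * v 1 - u 1 * v 0

lemma wedge_self (u : Fin 2 → ℂ) : wedge u u = 0 := by
  simp only [wedge]; ring

lemma wedge_smul_right (c : ℂ) (u v : Fin 2 → ℂ) : wedge u (c • v) = c * wedge u v := by
  simp only [wedge, Pi.smul_apply, smul_eq_mul]; ring

lemma norm_wedge_le (u v : Fin 2 → ℂ) : ‖wedge u v‖ ≤ 2 * ‖u‖ * ‖v‖ := by
  have h0 := mul_le_mul (norm_le_pi_norm u 0) (norm_le_pi_norm v 1) (norm_nonneg _) (norm_nonneg _)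
  have h1 := mul_le_mul (norm_le_pi_norm u 1) (norm_le_pi_norm v 0) (norm_nonneg _) (norm_nonneg _)
  have h := norm_sub_le (u 0 * v 1) (u 1 * v 0)
  rw [norm_mul, norm_mul] at h
  rw [wedge]
  linarith

lemma wedge_mulVec (g : Matrix.SpecialLinearGroup (Fin 2) ℂ) (u v : Fin 2 → ℂ) :
    wedge (g.1.mulVec u) (g.1.mulVec v) = wedge u v := by
  have h := g.2
  rw [Matrix.det_fin_two] at h
  simp only [wedge, Matrix.mulVec, dotProduct, Fin.sum_univ_two]
  linear_combination (u 0 * v 1 - u 1 * v 0) * h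

lemma exists_smul_of_wedge_eq_zero {p q : Fin 2 → ℂ} (hp : p ≠ 0) (h : wedge p q = 0) :
    ∃ c : ℂ, q = c • p := by
  rw [wedge] at h
  by_cases h0 : p 0 = 0
  · have h1 : p 1 ≠ 0 := by
      intro h1
      apply hp
      ext i
      fin_cases i <;> simp [h0, h1]
    refine ⟨q 1 / p 1, ?_⟩
    have hq : q 0 = 0 := by simpa [h0, h1] using h
    ext i
    fin_cases i
    · simp [h0, hq]
    · simp [h1]
  · refine ⟨q 0 / p 0, ?_⟩
    ext i
    fin_cases i
    · simp [h0]
    · simp only [Fin.mk_one, Pi.smul_apply, smul_eq_mul]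
      field_simp
      linear_combination h

/-- A vector cannot be close to two independent directions. -/
lemma norm_wedge_mul_norm_le (p q v : Fin 2 → ℂ) :
    ‖wedge p q‖ * ‖v‖ ≤ ‖wedge v q‖ * ‖p‖ + ‖wedge v p‖ * ‖q‖ := by
  have h : wedge p q • v = wedge v q • p - wedge v p • q := by
    ext i
    fin_cases i <;> simp [wedge] <;> ring
  have := norm_sub_le (wedge v q • p) (wedge v p • q)
  rw [← h] at this
  simpa only [norm_smul] using this

/-- The vectors whose direction is `ε`-close to that of `p`. -/
def nearSet (ε : ℝ) (p : Fin 2 → ℂ) : Set (Matrix.SpecialLinearGroup (Fin 2) ℂ) :=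
  {M | ‖wedge (M.1.mulVec ![1, 0]) p‖ < ε * ‖M.1.mulVec ![1, 0]‖}

lemma mem_nearSet {ε : ℝ} {p : Fin 2 → ℂ} {M : Matrix.SpecialLinearGroup (Fin 2) ℂ} :
    M ∈ nearSet ε p ↔ ‖wedge (M.1.mulVec ![1, 0]) p‖ < ε * ‖M.1.mulVec ![1, 0]‖ :=
  Iff.rfl

lemma mulVec_ne_zero_of_ne_zero (M : Matrix.SpecialLinearGroup (Fin 2) ℂ) {v : Fin 2 → ℂ}
    (hv : v ≠ 0) : M.1.mulVec v ≠ 0 := by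
  intro h
  have := Matrix.exists_mulVec_eq_zero_iff.1 ⟨v, hv, h⟩
  rw [M.2] at this
  exact one_ne_zero this

lemma basis_vector_ne_zero : (![1, 0] : Fin 2 → ℂ) ≠ 0 := fun h => by
  simpa using congrFun h 0

lemma nearSet_nonempty {ε : ℝ} (hε : 0 < ε) {p : Fin 2 → ℂ} (hp : p ≠ 0) :
    (nearSet ε p).Nonempty := by
  obtain ⟨a, b, hab⟩ : ∃ a b : ℂ, p 0 * b - a * p 1 = 1 := by
    by_cases h0 : p 0 = 0
    · have h1 : p 1 ≠ 0 := by
        intro h1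
        apply hp
        ext i
        fin_cases i <;> simp [h0, h1]
      exact ⟨-(p 1)⁻¹, 0, by field_simp; simp⟩
    · exact ⟨0, (p 0)⁻¹, by field_simp; simp⟩
  let M : Matrix.SpecialLinearGroup (Fin 2) ℂ :=
    ⟨!![p 0, a; p 1, b], by rw [Matrix.det_fin_two_of]; exact hab⟩
  have h : M.1.mulVec ![1, 0] = p := by
    ext i
    fin_cases i <;> simp [M, Matrix.mulVec, dotProduct]
  refine ⟨M, mem_nearSet.2 ?_⟩
  rw [h, wedge_self, norm_zero]
  have := norm_pos_iff.2 hp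
  positivity

lemma disjoint_nearSet {ε : ℝ} {p q : Fin 2 → ℂ} (h0 : p ≠ 0)
    (h : ε * (‖p‖ + ‖q‖) ≤ ‖wedge p q‖) :
    Disjoint (nearSet ε p) (nearSet ε q) := by
  rw [Set.disjoint_left]
  intro M hp hq
  rw [mem_nearSet] at hp hq
  set v := M.1.mulVec ![1, 0]
  have hv : 0 < ‖v‖ := norm_pos_iff.2 (mulVec_ne_zero_of_ne_zero M basis_vector_ne_zero)
  have h1 := norm_wedge_mul_norm_le p q v
  have h2 := mul_le_mul_of_nonneg_right h hv.le
  have h3 := mul_lt_mul_of_pos_right hq (norm_pos_iff.2 h0)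
  have h4 := mul_le_mul_of_nonneg_right hp.le (norm_nonneg q)
  linarith

open Pointwise in
lemma smul_compl_nearSet_subset {ε : ℝ} (hε : 0 < ε) {g : Matrix.SpecialLinearGroup (Fin 2) ℂ}
    {p q : Fin 2 → ℂ} {μ : ℂ} (hμ : μ ≠ 0) (hgp : g.1.mulVec p = μ • p)
    (hgq : g.1.mulVec q = μ⁻¹ • q) (hlarge : 4 * ‖p‖ * ‖q‖ < ε ^ 2 * ‖μ‖ ^ 2) :
    g • (nearSet ε q)ᶜ ⊆ nearSet ε p := by
  rintro _ ⟨M, hM, rfl⟩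
  simp only [mem_nearSet, Set.mem_compl_iff, not_lt, smul_eq_mul,
    Matrix.SpecialLinearGroup.coe_mul] at hM ⊢
  rw [← Matrix.mulVec_mulVec]
  set v := M.1.mulVec ![1, 0]
  have hv : 0 < ‖v‖ := norm_pos_iff.2 (mulVec_ne_zero_of_ne_zero M basis_vector_ne_zero)
  have hμ' : 0 < ‖μ‖ := norm_pos_iff.2 hμ
  have h1 : ‖μ‖ * ‖wedge (g.1.mulVec v) p‖ = ‖wedge v p‖ := by
    rw [← wedge_mulVec g v p, hgp, wedge_smul_right, norm_mul]
  have h2 : ‖wedge (g.1.mulVec v) q‖ = ‖μ‖ * ‖wedge v q‖ := by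
    rw [← wedge_mulVec g v q, hgq, wedge_smul_right, norm_mul, norm_inv]
    field_simp
  have h3 := norm_wedge_le v p
  have h4 := norm_wedge_le (g.1.mulVec v) q
  set z := g.1.mulVec v
  have h5 : ‖μ‖ * (ε * ‖v‖) ≤ 2 * ‖z‖ * ‖q‖ := by
    rw [h2] at h4
    exact (mul_le_mul_of_nonneg_left hM hμ'.le).trans h4
  have hz : 0 < ‖z‖ := norm_pos_iff.2 (mulVec_ne_zero_of_ne_zero g (norm_pos_iff.1 hv))
  by_contra! hcon
  have h6 : ε * ‖z‖ * ‖μ‖ ≤ 2 * ‖v‖ * ‖p‖ := by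
    nlinarith
  have h7 : (ε * ‖z‖ * ‖μ‖) * (‖μ‖ * (ε * ‖v‖)) ≤ (2 * ‖v‖ * ‖p‖) * (2 * ‖z‖ * ‖q‖) :=
    mul_le_mul h6 h5 (by positivity) (by positivity)
  have h8 : 4 * ‖p‖ * ‖q‖ * (‖z‖ * ‖v‖) < ε ^ 2 * ‖μ‖ ^ 2 * (‖z‖ * ‖v‖) :=
    mul_lt_mul_of_pos_right hlarge (by positivity)
  nlinarith

lemma pow_mulVec_of_mulVec {g : Matrix (Fin 2) (Fin 2) ℂ} {p : Fin 2 → ℂ} {μ : ℂ}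
    (h : g.mulVec p = μ • p) (n : ℕ) : (g ^ n).mulVec p = μ ^ n • p := by
  induction n with
  | zero => simp
  | succ n ih =>
    rw [pow_succ, ← Matrix.mulVec_mulVec, h, Matrix.mulVec_smul, ih, smul_smul, pow_succ, mul_comm]

lemma inv_mulVec_of_mulVec {g : Matrix.SpecialLinearGroup (Fin 2) ℂ} {p : Fin 2 → ℂ} {μ : ℂ}
    (hμ : μ ≠ 0) (h : g.1.mulVec p = μ • p) : (g⁻¹).1.mulVec p = μ⁻¹ • p := by
  have : (g⁻¹).1.mulVec (g.1.mulVec p) = p := by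
    rw [Matrix.mulVec_mulVec, ← Matrix.SpecialLinearGroup.coe_mul]
    simp
  rw [h, Matrix.mulVec_smul] at this
  rw [eq_inv_smul_iff₀ hμ, this]

/-- A matrix in `SL₂(ℂ)` with trace outside `[-2, 2]` is loxodromic. -/
lemma exists_loxodromic_eigenvectors (g : Matrix.SpecialLinearGroup (Fin 2) ℂ)
    (hg : ∀ r : ℝ, |r| ≤ 2 → g.1.trace ≠ r) :
    ∃ (μ : ℂ) (p q : Fin 2 → ℂ), 1 < ‖μ‖ ∧ p ≠ 0 ∧ q ≠ 0 ∧ g.1.mulVec p = μ • p ∧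
      g.1.mulVec q = μ⁻¹ • q := by
  have hvec : ∀ μ : ℂ, μ ^ 2 - g.1.trace * μ + 1 = 0 → ∃ p, p ≠ 0 ∧ g.1.mulVec p = μ • p := by
    intro μ hμ
    have hdet : (g.1 - Matrix.scalar (Fin 2) μ).det = 0 := by
      have h := g.2
      rw [Matrix.det_fin_two] at h
      rw [Matrix.trace_fin_two] at hμ
      rw [Matrix.det_fin_two]
      simp
      linear_combination hμ + h
    obtain ⟨p, hp, h⟩ := Matrix.exists_mulVec_eq_zero_iff.2 hdet
    refine ⟨p, hp, ?_⟩
    rw [Matrix.sub_mulVec, sub_eq_zero] at h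
    rw [h]
    ext i
    simp [Matrix.scalar_apply, Matrix.mulVec_diagonal]
  obtain ⟨μ, hμ⟩ : ∃ μ : ℂ, μ ^ 2 - g.1.trace * μ + 1 = 0 := by
    obtain ⟨s, hs⟩ := IsAlgClosed.exists_pow_nat_eq (g.1.trace ^ 2 - 4) (n := 2) (by norm_num)
    exact ⟨(g.1.trace + s) / 2, by linear_combination hs / 4⟩
  have hμ0 : μ ≠ 0 := by
    rintro rfl
    simp at hμ
  have hμinv : μ⁻¹ ^ 2 - g.1.trace * μ⁻¹ + 1 = 0 := by
    field_simp
    linear_combination hμ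
  have htr : g.1.trace = μ + μ⁻¹ := by
    field_simp
    linear_combination -hμ
  have hne : ‖μ‖ ≠ 1 := by
    intro h1
    apply hg (2 * μ.re)
    · rw [abs_mul, abs_two]
      have := Complex.abs_re_le_norm μ
      rw [h1] at this
      linarith
    · rw [htr, Complex.inv_eq_conj h1, Complex.add_conj]
  obtain ⟨p, hp, hgp⟩ := hvec μ hμ
  obtain ⟨q, hq, hgq⟩ := hvec μ⁻¹ hμinv
  rcases lt_or_gt_of_ne hne with h | h
  · refine ⟨μ⁻¹, q, p, ?_, hq, hp, hgq, by rwa [inv_inv]⟩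
    rw [norm_inv]
    exact (one_lt_inv₀ (norm_pos_iff.2 hμ0)).2 h
  · exact ⟨μ, p, q, h, hp, hq, hgp, hgq⟩

lemma wedge_ne_zero_of_eigenvalue_ne {g : Matrix (Fin 2) (Fin 2) ℂ} {p q : Fin 2 → ℂ} {μ ν : ℂ}
    (hp : p ≠ 0) (hq : q ≠ 0) (hgp : g.mulVec p = μ • p) (hgq : g.mulVec q = ν • q)
    (h : μ ≠ ν) : wedge p q ≠ 0 := by
  intro h0
  obtain ⟨c, rfl⟩ := exists_smul_of_wedge_eq_zero hp h0
  rw [Matrix.mulVec_smul, hgp, smul_comm] at hgq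
  have := smul_left_injective ℂ hq hgq
  exact h this

lemma wedge_ne_zero_of_det_commutator_ne_zero {g h : Matrix (Fin 2) (Fin 2) ℂ}
    (hdet : (g * h - h * g).det ≠ 0) {p q : Fin 2 → ℂ} {μ ν : ℂ} (hp : p ≠ 0) (hq : q ≠ 0)
    (hgp : g.mulVec p = μ • p) (hhq : h.mulVec q = ν • q) : wedge p q ≠ 0 := by
  intro h0
  obtain ⟨c, rfl⟩ := exists_smul_of_wedge_eq_zero hp h0
  apply hdet
  refine Matrix.exists_mulVec_eq_zero_iff.1 ⟨c • p, hq, ?_⟩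
  rw [Matrix.sub_mulVec, ← Matrix.mulVec_mulVec, ← Matrix.mulVec_mulVec, hhq, Matrix.mulVec_smul,
    Matrix.mulVec_smul g, hgp, smul_comm c μ, Matrix.mulVec_smul h, hhq, smul_comm, sub_self]

/-- Powers of two loxodromic matrices without common eigenvectors generate a free group. -/
theorem exists_pow_lift_injective (g : Fin 2 → Matrix.SpecialLinearGroup (Fin 2) ℂ)
    (hg : ∀ i, ∀ r : ℝ, |r| ≤ 2 → (g i).1.trace ≠ r)
    (hdet : ((g 0).1 * (g 1).1 - (g 1).1 * (g 0).1).det ≠ 0) :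
    ∃ n : ℕ, Function.Injective (FreeGroup.lift fun i => g i ^ n) := by
  choose μ p q hμ hp hq hgp hgq using fun i => exists_loxodromic_eigenvectors (g i) (hg i)
  have hμ0 : ∀ i, μ i ≠ 0 := fun i => norm_pos_iff.1 (one_pos.trans (hμ i))
  have hpq : ∀ i, wedge (p i) (q i) ≠ 0 := by
    intro i
    refine wedge_ne_zero_of_eigenvalue_ne (hp i) (hq i) (hgp i) (hgq i) fun h => ?_
    have h1 := hμ i
    have h2 := congrArg norm h
    rw [norm_inv] at h2
    have h3 := inv_lt_one_of_one_lt₀ h1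
    linarith
  have hcross : ∀ i j, i ≠ j → ∀ u v : Fin 2 → ℂ, ∀ a b : ℂ, u ≠ 0 → v ≠ 0 →
      (g i).1.mulVec u = a • u → (g j).1.mulVec v = b • v → wedge u v ≠ 0 := by
    intro i j hij u v a b hu hv hu' hv'
    refine wedge_ne_zero_of_det_commutator_ne_zero ?_ hu hv hu' hv'
    fin_cases i <;> fin_cases j
    · exact absurd rfl hij
    · exact hdet
    · simp only [Fin.mk_one, Fin.zero_eta, Fin.isValue]
      rw [← neg_sub, Matrix.det_neg]
      simpa using hdet
    · exact absurd rfl hij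
  have hbound : ∀ u v : Fin 2 → ℂ, u ≠ 0 → wedge u v ≠ 0 →
      ∀ᶠ ε in nhdsWithin (0 : ℝ) (Set.Ioi 0), Disjoint (nearSet ε u) (nearSet ε v) := by
    intro u v hu huv
    have h : Filter.Tendsto (fun ε : ℝ => ε * (‖u‖ + ‖v‖)) (nhdsWithin 0 (Set.Ioi 0)) (nhds 0) := by
      have : Continuous fun ε : ℝ => ε * (‖u‖ + ‖v‖) := by fun_prop
      simpa using (this.tendsto 0).mono_left nhdsWithin_le_nhds
    filter_upwards [h.eventually_le_const (norm_pos_iff.2 huv)] with ε hε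
    exact disjoint_nearSet hu hε
  have hev : ∀ᶠ ε in nhdsWithin (0 : ℝ) (Set.Ioi 0), 0 < ε ∧
      (∀ i j, Disjoint (nearSet ε (p i)) (nearSet ε (q j))) ∧
      ∀ i j, i ≠ j → Disjoint (nearSet ε (p i)) (nearSet ε (p j)) ∧
        Disjoint (nearSet ε (q i)) (nearSet ε (q j)) := by
    refine Filter.Eventually.and self_mem_nhdsWithin (.and ?_ ?_)
    · refine Filter.eventually_all.2 fun i => Filter.eventually_all.2 fun j => hbound _ _ (hp i) ?_
      by_cases hij : i = j
      · exact hij ▸ hpq i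
      · exact hcross i j hij _ _ _ _ (hp i) (hq j) (hgp i) (hgq j)
    · refine Filter.eventually_all.2 fun i => Filter.eventually_all.2 fun j => ?_
      by_cases hij : i = j
      · exact .of_forall fun _ h => absurd hij h
      · filter_upwards [hbound _ _ (hp i) (hcross i j hij _ _ _ _ (hp i) (hp j) (hgp i) (hgp j)),
          hbound _ _ (hq i) (hcross i j hij _ _ _ _ (hq i) (hq j) (hgq i) (hgq j))] with ε h1 h2 _
        exact ⟨h1, h2⟩
  obtain ⟨ε, hε, hXY, hdisj⟩ := hev.exists
  obtain ⟨n, hn⟩ : ∃ n : ℕ, ∀ i, 4 * ‖p i‖ * ‖q i‖ < ε ^ 2 * ‖μ i ^ n‖ ^ 2 := by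
    have h : ∀ᶠ n : ℕ in Filter.atTop, ∀ i, 4 * ‖p i‖ * ‖q i‖ < ε ^ 2 * ‖μ i ^ n‖ ^ 2 := by
      refine Filter.eventually_all.2 fun i => ?_
      have h1 : Filter.Tendsto (fun n : ℕ => ε ^ 2 * (‖μ i‖ ^ 2) ^ n) Filter.atTop Filter.atTop :=
        (tendsto_pow_atTop_atTop_of_one_lt (one_lt_pow₀ (hμ i) two_ne_zero)).const_mul_atTop
          (by positivity)
      filter_upwards [h1.eventually_gt_atTop (4 * ‖p i‖ * ‖q i‖)] with n hn
      rwa [norm_pow, ← pow_mul, mul_comm n, pow_mul]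
    exact h.exists
  have hp' : ∀ i, (g i ^ n).1.mulVec (p i) = μ i ^ n • p i := fun i =>
    (Matrix.SpecialLinearGroup.coe_pow (g i) n).symm ▸ pow_mulVec_of_mulVec (hgp i) n
  have hq' : ∀ i, (g i ^ n).1.mulVec (q i) = (μ i ^ n)⁻¹ • q i := fun i => by
    rw [← inv_pow]
    exact (Matrix.SpecialLinearGroup.coe_pow (g i) n).symm ▸ pow_mulVec_of_mulVec (hgq i) n
  refine ⟨n, FreeGroup.injective_lift_of_ping_pong _ (fun i => nearSet ε (p i))
    (fun i => nearSet ε (q i)) (fun i => nearSet_nonempty hε (hp i))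
    (fun i j hij => (hdisj i j hij).1) (fun i j hij => (hdisj i j hij).2) hXY (fun i => ?_)
    fun i => ?_⟩
  · exact smul_compl_nearSet_subset hε (pow_ne_zero _ (hμ0 i)) (hp' i) (hq' i) (hn i)
  · refine smul_compl_nearSet_subset (μ := μ i ^ n) hε (pow_ne_zero _ (hμ0 i)) ?_ ?_ ?_
    · simpa using inv_mulVec_of_mulVec (inv_ne_zero (pow_ne_zero n (hμ0 i))) (hq' i)
    · exact inv_mulVec_of_mulVec (pow_ne_zero n (hμ0 i)) (hp' i)
    · have := hn i
      linarith

section NormalForm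

variable {R : Type*} [Ring R] [Algebra ℂ R]

/-- The relations satisfied by a pair of matrices in `SL₂` with traces `0`, `1` whose product has
trace `t`. -/
structure TraceRel (X Y : R) (t : ℂ) : Prop where
  sq_left : X * X = -1
  sq_right : Y * Y = Y - 1
  mul_swap : Y * X = t • (1 : R) + X - X * Y

/-- The combination of `1, X, Y, XY` with the given coefficients. -/
def normalForm (X Y : R) (a b c d : ℂ) : R := a • (1 : R) + b • X + c • Y + d • (X * Y)

namespace TraceRel

variable {X Y : R} {t : ℂ}

lemma left_mul_normalForm (h : TraceRel X Y t) (a b c d : ℂ) :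
    X * normalForm X Y a b c d = normalForm X Y (-b) a (-d) c := by
  have h1 : X * (X * Y) = -Y := by rw [← mul_assoc, h.sq_left]; simp
  simp only [normalForm, mul_add, mul_smul_comm, mul_one, h.sq_left, h1]
  module

lemma right_mul_normalForm (h : TraceRel X Y t) (a b c d : ℂ) :
    Y * normalForm X Y a b c d = normalForm X Y (t * b - c) (b + d) (a + c + t * d) (-b) := by
  have h1 : Y * (X * Y) = t • Y + X := by
    rw [← mul_assoc, h.mul_swap, sub_mul, add_mul, mul_assoc, h.sq_right, mul_sub, mul_one]
    rw [smul_mul_assoc, one_mul]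
    abel
  simp only [normalForm, mul_add, mul_smul_comm, mul_one, h.sq_right, h.mul_swap, h1]
  module

lemma mul_normalForm (h : TraceRel X Y t) (a b c d : ℂ) :
    X * Y ^ 1 * normalForm X Y a b c d =
      normalForm X Y (-(b + d)) (t * b - c) b (a + c + t * d) := by
  rw [pow_one, mul_assoc, h.right_mul_normalForm, h.left_mul_normalForm, neg_neg]

lemma mul_sq_normalForm (h : TraceRel X Y t) (a b c d : ℂ) :
    X * Y ^ 2 * normalForm X Y a b c d =
      normalForm X Y (-d) (t * b - c - a) (b + d) (a + t * d) := by
  rw [pow_two, mul_assoc, mul_assoc, h.right_mul_normalForm, h.right_mul_normalForm,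
    h.left_mul_normalForm]
  congr 1 <;> ring

end TraceRel

end NormalForm

lemma X_mul_mem_degreeLT {n : ℕ} {p : ℤ[X]} (hp : p ∈ degreeLT ℤ n) :
    X * p ∈ degreeLT ℤ (n + 1) := by
  rw [mem_degreeLT] at hp ⊢
  rcases eq_or_ne p 0 with rfl | h0
  · simp
  · rw [degree_eq_natDegree h0] at hp
    rw [mul_comm, degree_mul, degree_X, degree_eq_natDegree h0]
    norm_cast at hp ⊢
    omega

lemma X_pow_mem_degreeLT {m n : ℕ} (h : m < n) : (X ^ m : ℤ[X]) ∈ degreeLT ℤ n := by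
  rw [mem_degreeLT, degree_X_pow]
  exact_mod_cast h

lemma mem_degreeLT_of_sub_X_pow {n : ℕ} {e : ℤ[X]} (he : e - X ^ n ∈ degreeLT ℤ n) :
    e ∈ degreeLT ℤ (n + 1) := by
  simpa using add_mem (degreeLT_mono n.le_succ he) (X_pow_mem_degreeLT n.lt_succ_self)

/-- Coefficients of the normal form of a word of odd length `2 * m + 1`. -/
structure OddForm (l : List ℕ) (m : ℕ) (p q r e : ℤ[X]) : Prop where
  mem_p : p ∈ degreeLT ℤ m
  mem_q : q ∈ degreeLT ℤ (m + 1)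
  mem_r : r ∈ degreeLT ℤ m
  mem_e : e - X ^ m ∈ degreeLT ℤ m
  prod_eq : ∀ {R : Type} [Ring R] [Algebra ℂ R] (x y : R) (t : ℂ), TraceRel x y t →
    (l.map fun k => x * y ^ k).prod = normalForm x y (t * aeval (t ^ 2) p) (aeval (t ^ 2) q)
      (t * aeval (t ^ 2) r) (aeval (t ^ 2) e)

/-- Coefficients of the normal form of a word of even length `2 * m + 2`. -/
structure EvenForm (l : List ℕ) (m : ℕ) (p q r e : ℤ[X]) : Prop where
  mem_p : p ∈ degreeLT ℤ (m + 1)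
  mem_q : q ∈ degreeLT ℤ (m + 1)
  mem_r : r ∈ degreeLT ℤ (m + 1)
  mem_e : e - X ^ m ∈ degreeLT ℤ m
  prod_eq : ∀ {R : Type} [Ring R] [Algebra ℂ R] (x y : R) (t : ℂ), TraceRel x y t →
    (l.map fun k => x * y ^ k).prod = normalForm x y (aeval (t ^ 2) p) (t * aeval (t ^ 2) q)
      (aeval (t ^ 2) r) (t * aeval (t ^ 2) e)

lemma OddForm.cons {l : List ℕ} {m : ℕ} {p q r e : ℤ[X]} (h : OddForm l m p q r e) {k : ℕ}
    (hk : k = 1 ∨ k = 2) : ∃ p' q' r' e', EvenForm (k :: l) m p' q' r' e' := by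
  have hp := degreeLT_mono m.le_succ h.mem_p
  have hr := degreeLT_mono m.le_succ h.mem_r
  have he := mem_degreeLT_of_sub_X_pow h.mem_e
  rcases hk with rfl | rfl
  · refine ⟨-(q + e), q - r, q, p + r + e, neg_mem (add_mem h.mem_q he), sub_mem h.mem_q hr,
      h.mem_q, ?_, fun x y t hxy => ?_⟩
    · rw [add_sub_assoc]
      exact add_mem (add_mem h.mem_p h.mem_r) h.mem_e
    · rw [List.map_cons, List.prod_cons, h.prod_eq x y t hxy, hxy.mul_normalForm]
      simp only [map_neg, map_add, map_sub]
      congr 1 <;> ring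
  · refine ⟨-e, q - r - p, q + e, p + e, neg_mem he, sub_mem (sub_mem h.mem_q hr) hp,
      add_mem h.mem_q he, ?_, fun x y t hxy => ?_⟩
    · rw [add_sub_assoc]
      exact add_mem h.mem_p h.mem_e
    · rw [List.map_cons, List.prod_cons, h.prod_eq x y t hxy, hxy.mul_sq_normalForm]
      simp only [map_neg, map_add, map_sub]
      congr 1 <;> ring

lemma EvenForm.cons {l : List ℕ} {m : ℕ} {p q r e : ℤ[X]} (h : EvenForm l m p q r e) {k : ℕ}
    (hk : k = 1 ∨ k = 2) : ∃ p' q' r' e', OddForm (k :: l) (m + 1) p' q' r' e' := by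
  have he := mem_degreeLT_of_sub_X_pow h.mem_e
  have hr := degreeLT_mono (m + 1).le_succ h.mem_r
  have hp := degreeLT_mono (m + 1).le_succ h.mem_p
  have hXe : X * e - X ^ (m + 1) ∈ degreeLT ℤ (m + 1) := by
    rw [pow_succ', ← mul_sub]
    exact X_mul_mem_degreeLT h.mem_e
  rcases hk with rfl | rfl
  · refine ⟨-(q + e), X * q - r, q, p + r + X * e, neg_mem (add_mem h.mem_q he),
      sub_mem (X_mul_mem_degreeLT h.mem_q) hr, h.mem_q, ?_, fun x y t hxy => ?_⟩
    · rw [add_sub_assoc]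
      exact add_mem (add_mem h.mem_p h.mem_r) hXe
    · rw [List.map_cons, List.prod_cons, h.prod_eq x y t hxy, hxy.mul_normalForm]
      simp only [map_neg, map_add, map_sub, map_mul, aeval_X]
      congr 1 <;> ring
  · refine ⟨-e, X * q - r - p, q + e, p + X * e, neg_mem he,
      sub_mem (sub_mem (X_mul_mem_degreeLT h.mem_q) hr) hp, add_mem h.mem_q he, ?_,
      fun x y t hxy => ?_⟩
    · rw [add_sub_assoc]
      exact add_mem h.mem_p hXe
    · rw [List.map_cons, List.prod_cons, h.prod_eq x y t hxy, hxy.mul_sq_normalForm]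
      simp only [map_neg, map_add, map_sub, map_mul, aeval_X]
      congr 1 <;> ring

lemma exists_oddForm (m : ℕ) : ∀ l : List ℕ, l.length = 2 * m + 1 → (∀ k ∈ l, k = 1 ∨ k = 2) →
    ∃ p q r e, OddForm l m p q r e := by
  induction m with
  | zero =>
    intro l hl hk
    obtain ⟨k, rfl⟩ := List.length_eq_one_iff.1 hl
    have hzero : (0 : ℤ[X]) ∈ degreeLT ℤ 0 := zero_mem _
    have hone : (1 : ℤ[X]) ∈ degreeLT ℤ 1 := by simpa using X_pow_mem_degreeLT zero_lt_one
    rcases hk k (by simp) with rfl | rfl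
    · refine ⟨0, 0, 0, 1, hzero, zero_mem _, hzero, by simp, fun x y t _ => ?_⟩
      simp [normalForm]
    · refine ⟨0, -1, 0, 1, hzero, neg_mem hone, hzero, by simp, fun x y t h => ?_⟩
      simp [normalForm, pow_two, h.sq_right, mul_sub]
      abel
  | succ m ih =>
    intro l hl hk
    match l, hl, hk with
    | k₁ :: k₂ :: l, hl, hk =>
      obtain ⟨p, q, r, e, h⟩ := ih l (by simp at hl; omega) fun k hk' => hk k (by simp [hk'])
      obtain ⟨p', q', r', e', h'⟩ := h.cons (hk k₂ (by simp))
      exact h'.cons (hk k₁ (by simp))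

/-- The trace polynomial of a word of odd length `2 * m + 1`, divided by the trace variable and
written in terms of its square. -/
noncomputable def oddTracePoly (p r e : ℤ[X]) : ℤ[X] := 2 * p + r + e

namespace OddForm

variable {l : List ℕ} {m : ℕ} {p q r e : ℤ[X]}

lemma sub_X_pow_mem (h : OddForm l m p q r e) : oddTracePoly p r e - X ^ m ∈ degreeLT ℤ m := by
  rw [oddTracePoly, add_sub_assoc, two_mul]
  exact add_mem (add_mem (add_mem h.mem_p h.mem_p) h.mem_r) h.mem_e

lemma monic (h : OddForm l m p q r e) : (oddTracePoly p r e).Monic := by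
  simpa using monic_X_pow_add (mem_degreeLT.1 h.sub_X_pow_mem)

lemma natDegree_eq (h : OddForm l m p q r e) : (oddTracePoly p r e).natDegree = m := by
  have := natDegree_eq_of_degree_eq_some
    ((degree_add_eq_right_of_degree_lt (p := oddTracePoly p r e - X ^ m) (q := X ^ m) (by
      rw [degree_X_pow]; exact mem_degreeLT.1 h.sub_X_pow_mem)).trans (degree_X_pow m))
  simpa using this

/-- The trace of a word in two matrices satisfying the trace relations. -/
lemma trace_eq (h : OddForm l m p q r e) {x y : Matrix (Fin 2) (Fin 2) ℂ} {t : ℂ}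
    (hxy : TraceRel x y t) (hx : x.trace = 0) (hy : y.trace = 1) (ht : (x * y).trace = t) :
    (l.map fun k => x * y ^ k).prod.trace = t * aeval (t ^ 2) (oddTracePoly p r e) := by
  rw [h.prod_eq x y t hxy]
  simp only [normalForm, oddTracePoly, Matrix.trace_add, Matrix.trace_smul, hx, hy, ht,
    Matrix.trace_one, Fintype.card_fin, smul_eq_mul, map_add, map_mul, map_ofNat]
  push_cast
  ring

lemma prod_map_comm (l : List ℕ) (u v : ℂ) :
    (l.map fun k => u * v ^ k).prod = u ^ l.length * v ^ l.sum := by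
  induction l with
  | nil => simp
  | cons k l ih =>
    rw [List.map_cons, List.prod_cons, ih, List.length_cons, List.sum_cons]
    ring

/-- The value at the reducible representations. -/
lemma aeval_three_sq (h : OddForm l m p q r e) (hlen : l.length = 2 * m + 1)
    (hsum : l.sum % 3 ≠ 0) : (aeval (3 : ℂ) (oddTracePoly p r e)) ^ 2 = 1 := by
  obtain ⟨t, ht⟩ := IsAlgClosed.exists_pow_nat_eq (3 : ℂ) (n := 2) (by norm_num)
  have hI := Complex.I_sq
  set ω : ℂ := (1 - Complex.I * t) / 2 with hω
  set ω' : ℂ := (1 + Complex.I * t) / 2 with hω'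
  have hωω : ω * ω' = 1 := by
    rw [hω, hω']
    linear_combination -t ^ 2 / 4 * hI + ht / 4
  have hω2 : ω ^ 2 = ω - 1 := by
    rw [hω]
    linear_combination t ^ 2 / 4 * hI - ht / 4
  have h1 : TraceRel Complex.I ω t :=
    ⟨Complex.I_mul_I, by rw [← pow_two, hω2], by
      rw [smul_eq_mul, hω]; linear_combination -t * hI⟩
  have h2 : TraceRel (-Complex.I) ω' t :=
    ⟨by simp, by rw [hω']; linear_combination t ^ 2 / 4 * hI - ht / 4, by
      rw [smul_eq_mul, hω']; linear_combination -t * hI⟩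
  have e1 := h.prod_eq _ _ t h1
  have e2 := h.prod_eq _ _ t h2
  rw [prod_map_comm] at e1 e2
  have hsumeq : Complex.I ^ l.length * ω ^ l.sum + (-Complex.I) ^ l.length * ω' ^ l.sum =
      t * aeval (3 : ℂ) (oddTracePoly p r e) := by
    rw [e1, e2, ht]
    simp only [normalForm, oddTracePoly, smul_eq_mul, map_add, map_mul, map_ofNat]
    rw [hω, hω']
    linear_combination -t * aeval (3 : ℂ) e * hI
  have hodd : Complex.I ^ l.length * (-Complex.I) ^ l.length = 1 := by
    rw [← mul_pow]; simp
  have hsq : (Complex.I ^ l.length) ^ 2 = -1 := by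
    rw [← pow_mul, mul_comm, pow_mul, hI, hlen, pow_succ, pow_mul]; simp
  have hsq' : ((-Complex.I) ^ l.length) ^ 2 = -1 := by
    rw [← pow_mul, mul_comm, pow_mul, neg_sq, hI, hlen, pow_succ, pow_mul]; simp
  have hpow : (ω ^ l.sum) ^ 2 + (ω' ^ l.sum) ^ 2 = -1 := by
    have hω3 : (ω ^ 2) ^ 3 = 1 := by
      have : ω ^ 3 = -1 := by linear_combination (ω + 1) * hω2
      linear_combination (ω ^ 3 - 1) * this
    have hω3' : (ω' ^ 2) ^ 3 = 1 := by
      have := congrArg (· ^ 6) hωω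
      simp only [mul_pow, one_pow] at this
      rw [← pow_mul] at hω3 ⊢
      rwa [hω3, one_mul] at this
    have hadd : ω + ω' = 1 := by rw [hω, hω']; ring
    have hsqadd : ω ^ 2 + ω' ^ 2 = -1 := by linear_combination (ω + ω' + 1) * hadd - 2 * hωω
    rw [← pow_mul, ← pow_mul, mul_comm, pow_mul, pow_mul, ← Nat.div_add_mod l.sum 3, pow_add,
      pow_add, pow_mul _ 3, pow_mul _ 3, hω3, hω3', one_pow, one_mul, one_mul]
    have hlt := Nat.mod_lt l.sum (show 3 > 0 by norm_num)
    generalize l.sum % 3 = k at *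
    interval_cases k
    · exact absurd rfl hsum
    · simpa using hsqadd
    · linear_combination (ω ^ 2 + ω' ^ 2 - 1) * hsqadd - 2 * (ω * ω' + 1) * hωω
  have hprod : ω ^ l.sum * ω' ^ l.sum = 1 := by rw [← mul_pow, hωω, one_pow]
  have hfinal : t ^ 2 * aeval (3 : ℂ) (oddTracePoly p r e) ^ 2 = 3 := by
    rw [← mul_pow, ← hsumeq, add_sq, mul_pow, mul_pow, hsq, hsq']
    linear_combination -hpow + 2 * ω ^ l.sum * ω' ^ l.sum * hodd + 2 * hprod
  rw [ht] at hfinal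
  linear_combination hfinal / 3

end OddForm

section Representation

open Complex

/-- The image of the generator of order two. -/
def repX : Matrix (Fin 2) (Fin 2) ℂ := !![I, 0; 0, -I]

/-- The image of the generator of order three, in the representation with trace parameter `t`,
where `4 * b ^ 2 = 3 - t ^ 2`. -/
noncomputable def repY (t b : ℂ) : Matrix (Fin 2) (Fin 2) ℂ :=
  !![(1 - I * t) / 2, b; -b, (1 + I * t) / 2]

lemma det_repX : repX.det = 1 := by
  simp [repX, Matrix.det_fin_two_of]

lemma trace_repX : repX.trace = 0 := by
  simp [repX, Matrix.trace_fin_two]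

lemma det_repY {t b : ℂ} (hb : 4 * b ^ 2 = 3 - t ^ 2) : (repY t b).det = 1 := by
  simp only [repY, Matrix.det_fin_two_of]
  linear_combination hb / 4 - t ^ 2 / 4 * I_sq

lemma trace_repY (t b : ℂ) : (repY t b).trace = 1 := by
  simp only [repY, Matrix.trace_fin_two_of]
  ring

lemma trace_repX_mul_repY (t b : ℂ) : (repX * repY t b).trace = t := by
  simp only [repX, repY, Matrix.trace_fin_two, Matrix.mul_fin_two, Matrix.of_apply,
    Matrix.cons_val', Matrix.cons_val_zero, Matrix.cons_val_one, Matrix.cons_val_fin_one]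
  linear_combination -t * I_sq

lemma traceRel_repX_repY {t b : ℂ} (hb : 4 * b ^ 2 = 3 - t ^ 2) : TraceRel repX (repY t b) t := by
  have hI := I_sq
  constructor
  · ext i j
    fin_cases i <;> fin_cases j <;> simp [repX]
  · ext i j
    fin_cases i <;> fin_cases j <;> simp [repY] <;> grind
  · ext i j
    fin_cases i <;> fin_cases j <;> simp [repX, repY] <;> grind

section Words

variable {X Y : Matrix (Fin 2) (Fin 2) ℂ} {t : ℂ}

lemma TraceRel.mul_sq_eq (h : TraceRel X Y t) : X * Y ^ 2 = normalForm X Y 0 (-1) 0 1 := by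
  rw [pow_two, h.sq_right, mul_sub, normalForm]
  simp [sub_eq_neg_add]

lemma mul_eq_normalForm (X Y : Matrix (Fin 2) (Fin 2) ℂ) : X * Y = normalForm X Y 0 0 0 1 := by
  simp [normalForm]

/-- The commutator of `XY` and `XY²` in normal form. -/
lemma TraceRel.commutator (h : TraceRel X Y t) :
    X * Y * (X * Y ^ 2) - X * Y ^ 2 * (X * Y) = 1 - (2 : ℂ) • Y - t • X := by
  have e1 := h.mul_normalForm 0 (-1) 0 1
  have e2 := h.mul_sq_normalForm 0 0 0 1
  rw [← h.mul_sq_eq, pow_one] at e1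
  rw [← mul_eq_normalForm] at e2
  rw [e1, e2]
  simp only [normalForm]
  module

/-- The commutator of `(XY)(XY²)` and `(XY²)(XY)` is a multiple of `X`. -/
lemma TraceRel.commutator_mul (h : TraceRel X Y t) :
    X * Y * (X * Y ^ 2) * (X * Y ^ 2 * (X * Y)) - X * Y ^ 2 * (X * Y) * (X * Y * (X * Y ^ 2)) =
      (t ^ 3 - 3 * t) • X := by
  have e1 := h.mul_normalForm 0 (-1) 0 1
  have e2 := h.mul_sq_normalForm 0 0 0 1
  rw [← h.mul_sq_eq] at e1
  rw [← mul_eq_normalForm] at e2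
  rw [mul_assoc (X * Y), mul_assoc (X * Y ^ 2) (X * Y), e2, h.mul_sq_normalForm]
  have e3 := h.mul_normalForm
  simp only [pow_one] at e1 e3
  rw [e1, e3, e3, h.mul_sq_normalForm]
  simp only [normalForm]
  module

end Words

lemma norm_list_trace_le {l : List ℕ} {x y : Matrix (Fin 2) (Fin 2) ℂ}
    (hx : x ∈ Matrix.unitaryGroup (Fin 2) ℂ) (hy : y ∈ Matrix.unitaryGroup (Fin 2) ℂ) :
    ‖(l.map fun k => x * y ^ k).prod.trace‖ ≤ 2 := by
  have h : (l.map fun k => x * y ^ k).prod ∈ Matrix.unitaryGroup (Fin 2) ℂ :=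
    list_prod_mem fun z hz => by
      obtain ⟨k, -, rfl⟩ := List.mem_map.1 hz
      exact mul_mem hx (pow_mem hy k)
  rw [Matrix.trace_fin_two]
  have h0 := entry_norm_bound_of_unitary h 0 0
  have h1 := entry_norm_bound_of_unitary h 1 1
  exact (norm_add_le _ _).trans (by linarith)

lemma repX_mem_unitaryGroup : repX ∈ Matrix.unitaryGroup (Fin 2) ℂ := by
  rw [Matrix.mem_unitaryGroup_iff]
  ext i j
  fin_cases i <;> fin_cases j <;> simp [repX, Matrix.star_apply, Matrix.mul_apply]

lemma repY_mem_unitaryGroup {t b : ℝ} (hb : 4 * b ^ 2 = 3 - t ^ 2) :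
    repY t b ∈ Matrix.unitaryGroup (Fin 2) ℂ := by
  rw [Matrix.mem_unitaryGroup_iff]
  have hb' : 4 * (b : ℂ) ^ 2 = 3 - (t : ℂ) ^ 2 := by exact_mod_cast hb
  have hI := I_sq
  ext i j
  have h2 : (starRingEnd ℂ) 2 = 2 := map_ofNat _ 2
  fin_cases i <;> fin_cases j <;> simp [repY, Matrix.star_apply, Matrix.mul_apply, h2] <;> grind

lemma det_commutator {t b : ℂ} (hb : 4 * b ^ 2 = 3 - t ^ 2) :
    (repX * repY t b * (repX * repY t b ^ 2) - repX * repY t b ^ 2 * (repX * repY t b)).det =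
      3 - t ^ 2 := by
  rw [(traceRel_repX_repY hb).commutator, Matrix.det_fin_two]
  simp [repX, repY]
  linear_combination hb

lemma det_commutator_mul {t b : ℂ} (hb : 4 * b ^ 2 = 3 - t ^ 2) :
    (repX * repY t b * (repX * repY t b ^ 2) * (repX * repY t b ^ 2 * (repX * repY t b)) -
      repX * repY t b ^ 2 * (repX * repY t b) * (repX * repY t b * (repX * repY t b ^ 2))).det =
      (t ^ 3 - 3 * t) ^ 2 := by
  rw [(traceRel_repX_repY hb).commutator_mul, Matrix.det_smul, det_repX]
  simp

lemma trace_repX_mul_repY_sq {t b : ℂ} (hb : 4 * b ^ 2 = 3 - t ^ 2) :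
    (repX * repY t b ^ 2).trace = t := by
  rw [(traceRel_repX_repY hb).mul_sq_eq]
  simp [normalForm, trace_repX, trace_repX_mul_repY]

lemma trace_commutator_words {t b : ℂ} (hb : 4 * b ^ 2 = 3 - t ^ 2) :
    (repX * repY t b * (repX * repY t b ^ 2)).trace = t ^ 2 - 1 := by
  have h := traceRel_repX_repY hb
  have e := h.mul_normalForm 0 (-1) 0 1
  rw [← h.mul_sq_eq, pow_one] at e
  rw [e]
  simp [normalForm, trace_repX, trace_repY, trace_repX_mul_repY]
  ring

end Representation

/-- On the unitary part of the representation variety, traces are at most two. -/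
lemma OddForm.eval_sq_le {l : List ℕ} {m : ℕ} {p q r e : ℤ[X]} (h : OddForm l m p q r e) {s : ℝ}
    (h0 : 0 ≤ s) (h3 : s ≤ 3) : s * (aeval s (oddTracePoly p r e)) ^ 2 ≤ 4 := by
  set t := Real.sqrt s with ht
  set b := Real.sqrt ((3 - s) / 4) with hb
  have hts : t ^ 2 = s := Real.sq_sqrt h0
  have hbt : 4 * b ^ 2 = 3 - t ^ 2 := by
    rw [hb, Real.sq_sqrt (by linarith), hts]; ring
  have hbt' : 4 * (b : ℂ) ^ 2 = 3 - (t : ℂ) ^ 2 := by exact_mod_cast hbt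
  have h1 := h.trace_eq (traceRel_repX_repY hbt') trace_repX (trace_repY _ _)
    (trace_repX_mul_repY _ _)
  have h2 := norm_list_trace_le (l := l) repX_mem_unitaryGroup (repY_mem_unitaryGroup hbt)
  have h4 : (aeval ((t : ℂ) ^ 2) (oddTracePoly p r e) : ℂ) =
      ((aeval s (oddTracePoly p r e) : ℝ) : ℂ) := by
    rw [← hts, ← Complex.ofReal_pow]
    exact aeval_algebraMap_apply (R := ℤ) (A := ℝ) ℂ (t ^ 2) _
  rw [h1, h4, ← Complex.ofReal_mul, Complex.norm_real, Real.norm_eq_abs] at h2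
  have h5 := sq_le_sq' (by linarith [abs_le.1 h2]) (abs_le.1 h2).2
  rw [mul_pow, hts] at h5
  linarith

section IntegerPolynomials

/-- A monic integer polynomial shares a root with every integer polynomial that is small at all of
its roots. -/
lemma exists_common_root {f Q : ℤ[X]} (hf : f.Monic) (hdeg : f.natDegree ≠ 0)
    (hQ : ∀ z : ℂ, aeval z f = 0 → ‖aeval z Q‖ < 1) :
    ∃ z : ℂ, aeval z f = 0 ∧ aeval z Q = 0 := by
  set φ := algebraMap ℤ ℂ
  have hmonic : (f.map φ).Monic := hf.map φ
  have hroot : ∀ z ∈ (f.map φ).roots, aeval z f = 0 := fun z hz => by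
    rw [← eval_map_algebraMap]
    exact (mem_roots'.1 hz).2
  have hres := resultant_eq_prod_eval (f.map φ) (Q.map φ) Q.natDegree natDegree_map_le
    (IsAlgClosed.splits _)
  rw [hmonic.leadingCoeff, one_pow, one_mul, hf.natDegree_map, resultant_map_map] at hres
  have hlt : ‖((f.map φ).roots.map fun z => (Q.map φ).eval z).prod‖ < 1 := by
    rw [← coe_nnnorm, ← NNReal.coe_one, NNReal.coe_lt_coe, ← nnnormHom_apply, map_multiset_prod,
      Multiset.map_map]
    have hne : (f.map φ).roots ≠ 0 := by
      rw [← Multiset.card_pos, ← (IsAlgClosed.splits (f.map φ)).natDegree_eq_card_roots,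
        hf.natDegree_map]
      exact Nat.pos_of_ne_zero hdeg
    obtain ⟨z, hz⟩ := Multiset.exists_mem_of_ne_zero hne
    have hsmall : ∀ z ∈ (f.map φ).roots, ‖(Q.map φ).eval z‖₊ < 1 := fun z hz => by
      have := hQ z (hroot z hz)
      rwa [eval_map_algebraMap]
    obtain ⟨s, hs⟩ := Multiset.exists_cons_of_mem hz
    rw [hs] at hsmall ⊢
    rw [Multiset.map_cons, Multiset.prod_cons]
    refine mul_lt_one_of_nonneg_of_lt_one_left zero_le (hsmall z (by simp))
      (Multiset.prod_induction (· ≤ 1) _ (fun a b ha hb => mul_le_one' ha hb) le_rfl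
        fun a ha => ?_)
    obtain ⟨u, hu, rfl⟩ := Multiset.mem_map.1 ha
    exact (hsmall u (by simp [hu])).le
  rw [← hres] at hlt
  have hzero : f.resultant Q f.natDegree Q.natDegree = 0 := by
    have : ‖((f.resultant Q f.natDegree Q.natDegree : ℤ) : ℂ)‖ < 1 := hlt
    rw [Complex.norm_intCast] at this
    exact Int.abs_lt_one_iff.1 (by exact_mod_cast this)
  rw [hzero, map_zero, eq_comm, Multiset.prod_eq_zero_iff, Multiset.mem_map] at hres
  obtain ⟨z, hz, hz0⟩ := hres
  exact ⟨z, hroot z hz, by rwa [eval_map_algebraMap] at hz0⟩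

lemma X_sub_C_dvd_of_aeval {f : ℤ[X]} {a : ℤ} (h : aeval (a : ℂ) f = 0) : X - C a ∣ f := by
  rw [dvd_iff_isRoot, IsRoot.def]
  have : (aeval (algebraMap ℤ ℂ a) f : ℂ) = 0 := by simpa using h
  rwa [aeval_algebraMap_apply_eq_algebraMap_eval, map_eq_zero_iff _ (by exact Int.cast_injective)]
    at this

lemma golden_monic : (X ^ 2 - 3 * X + 1 : ℤ[X]).Monic := by
  monicity!

lemma golden_natDegree : (X ^ 2 - 3 * X + 1 : ℤ[X]).natDegree = 2 := by
  compute_degree!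

lemma golden_dvd_of_aeval {f : ℤ[X]} {z : ℂ} (hz : z ^ 2 - 3 * z + 1 = 0) (h : aeval z f = 0) :
    X ^ 2 - 3 * X + 1 ∣ f := by
  rw [← modByMonic_eq_zero_iff_dvd golden_monic]
  have hdeg : (f %ₘ (X ^ 2 - 3 * X + 1)).natDegree ≤ 1 := by
    have := natDegree_modByMonic_lt f golden_monic (fun h => by
      have := golden_natDegree; rw [h] at this; simp at this)
    rw [golden_natDegree] at this
    omega
  obtain ⟨a, b, hab⟩ := exists_eq_X_add_C_of_natDegree_le_one hdeg
  have hz' : (a : ℂ) * z + b = 0 := by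
    have := congrArg (aeval z) (modByMonic_add_div f (X ^ 2 - 3 * X + 1 : ℤ[X]))
    rw [h, hab] at this
    simp only [map_add, map_mul, map_sub, map_pow, map_ofNat, map_one, aeval_X, aeval_C, hz,
      zero_mul, add_zero] at this
    exact this
  have hsq : (2 * b + 3 * a) * (2 * b + 3 * a) = 5 * (a * a) := by
    have : ((2 * b + 3 * a) * (2 * b + 3 * a) : ℂ) = 5 * (a * a) := by
      linear_combination (4 * a ^ 2 : ℂ) * hz + (4 * (b - a * z) + 12 * a) * hz'
    exact_mod_cast this
  have ha : a = 0 := by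
    by_contra ha
    refine Nat.Prime.irrational_sqrt Nat.prime_five ⟨|(2 * b + 3 * a) / a|, ?_⟩
    have ha' : (a : ℝ) ≠ 0 := by exact_mod_cast ha
    have hsq' : ((2 * b + 3 * a) * (2 * b + 3 * a) : ℝ) = 5 * (a * a) := by exact_mod_cast hsq
    push_cast
    rw [← Real.sqrt_sq_eq_abs, div_pow, pow_two, hsq', pow_two, mul_div_assoc,
      div_self (mul_ne_zero ha' ha'), mul_one]
  subst ha
  have hb : b = 0 := by simpa using hz'
  rw [hab, hb]
  simp

/-- A monic integer polynomial all of whose roots lie in `[0, 3]` and whose value at `3` is a unit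
is a product of powers of `X - 2` and `X ^ 2 - 3 * X + 1`. -/
lemma exists_eq_pow_mul_pow (n : ℕ) : ∀ f : ℤ[X], f.natDegree = n → f.Monic →
    (∀ z : ℂ, aeval z f = 0 → ∃ s : ℝ, z = s ∧ 0 ≤ s ∧ s ≤ 3) → f.eval 3 ^ 2 = 1 →
    ∃ c d, f = (X - C 2) ^ c * (X ^ 2 - 3 * X + 1) ^ d := by
  induction n using Nat.strong_induction_on with
  | _ n ih =>
    intro f hn hf hroots h3
    rcases Nat.eq_zero_or_pos n with rfl | hpos
    · exact ⟨0, 0, by simpa using hf.natDegree_eq_zero.1 hn⟩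
    have hstep : ∀ g h : ℤ[X], f = g * h → g.Monic → g.natDegree ≠ 0 →
        ∃ c d, h = (X - C 2) ^ c * (X ^ 2 - 3 * X + 1) ^ d := fun g h hgh hg hg0 => by
      have hh : h.Monic := hg.of_mul_monic_left (hgh ▸ hf)
      refine ih h.natDegree ?_ h rfl hh (fun z hz => hroots z (by rw [hgh, map_mul, hz, mul_zero]))
        ?_
      · rw [← hn, hgh, hg.natDegree_mul hh]
        omega
      · rw [hgh, eval_mul] at h3
        have := Int.isUnit_iff.1 (IsUnit.of_mul_eq_one (eval 3 g * (eval 3 g * eval 3 h))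
          (by linear_combination h3 : eval 3 h * (eval 3 g * (eval 3 g * eval 3 h)) = 1))
        rcases this with h | h <;> simp [h]
    have hunit : ∀ a : ℤ, X - C a ∣ f → (3 - a) * (3 - a) ∣ 1 := fun a ⟨g, hg⟩ => by
      rw [hg, eval_mul] at h3
      refine ⟨eval 3 g ^ 2, ?_⟩
      rw [eval_sub, eval_X, eval_C] at h3
      linear_combination -h3
    obtain ⟨z, hz, hQ⟩ := exists_common_root (Q := X * (X - 3) * (X - 1) * (X - 2) *
      (X ^ 2 - 3 * X + 1)) hf (by omega) fun z hz => by
        obtain ⟨s, rfl, hs0, hs3⟩ := hroots z hz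
        have : (aeval (s : ℂ) (X * (X - 3) * (X - 1) * (X - 2) * (X ^ 2 - 3 * X + 1 : ℤ[X])) : ℂ) =
            ((-(s * (3 - s) * (s * (3 - s) - 1) * (s * (3 - s) - 2)) : ℝ) : ℂ) := by
          simp only [map_mul, map_sub, map_add, map_pow, map_one, map_ofNat, aeval_X]
          push_cast
          ring
        rw [this, Complex.norm_real, Real.norm_eq_abs, abs_neg]
        have hw0 : 0 ≤ s * (3 - s) := mul_nonneg hs0 (by linarith)
        have hw1 : s * (3 - s) ≤ 9 / 4 := by nlinarith [sq_nonneg (2 * s - 3)]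
        generalize s * (3 - s) = w at hw0 hw1
        rw [abs_lt]
        constructor
        · nlinarith [mul_nonneg hw0 (sq_nonneg (w - 3/2))]
        · nlinarith [mul_nonneg hw0 (sub_nonneg.2 hw1),
            mul_nonneg (mul_nonneg hw0 hw0) (sub_nonneg.2 hw1)]
    simp only [map_mul, map_sub, map_add, map_pow, map_one, map_ofNat, aeval_X, mul_eq_zero] at hQ
    rcases hQ with (((h | h) | h) | h) | h
    · have := hunit 0 (X_sub_C_dvd_of_aeval (by simpa [h] using hz))
      norm_num at this
    · have := hunit 3 (X_sub_C_dvd_of_aeval (by simpa [sub_eq_zero.1 h] using hz))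
      norm_num at this
    · have := hunit 1 (X_sub_C_dvd_of_aeval (by simpa [sub_eq_zero.1 h] using hz))
      norm_num at this
    · obtain ⟨g, hg⟩ := X_sub_C_dvd_of_aeval (a := 2) (by simpa [sub_eq_zero.1 h] using hz)
      obtain ⟨c, d, hcd⟩ := hstep _ g hg (monic_X_sub_C 2) (by rw [natDegree_X_sub_C]; norm_num)
      exact ⟨c + 1, d, by rw [hg, hcd]; ring⟩
    · obtain ⟨g, hg⟩ := golden_dvd_of_aeval h hz
      obtain ⟨c, d, hcd⟩ := hstep _ g hg golden_monic (by rw [golden_natDegree]; norm_num)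
      exact ⟨c, d + 1, by rw [hg, hcd]; ring⟩

/-- Trace bounds at two points limit the exponents. -/
lemma exponent_bound {c d : ℕ}
    (h : ∀ s : ℝ, 0 ≤ s → s ≤ 3 → s * ((s - 2) ^ c * (s ^ 2 - 3 * s + 1) ^ d) ^ 2 ≤ 4) :
    c + 2 * d ≤ 24 := by
  have hone : ∀ {u : ℝ} (_ : 1 ≤ u) (k : ℕ), 1 ≤ u ^ k := fun hu k => one_le_pow₀ hu
  have hd : d ≤ 2 * c + 2 := by
    by_contra! hd
    obtain ⟨k, rfl⟩ := Nat.exists_eq_add_of_lt hd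
    have h1 := h (13 / 10) (by norm_num) (by norm_num)
    have h2 : ∀ u v : ℝ, (u ^ c * v ^ (2 * c + 2 + k + 1)) ^ 2 =
        (v ^ 2) ^ 3 * ((u ^ 2 * v ^ 4) ^ c * (v ^ 2) ^ k) := fun u v => by ring
    rw [h2] at h1
    have h3 := one_le_mul_of_one_le_of_one_le
      (hone (u := (13 / 10 - 2) ^ 2 * ((13 / 10) ^ 2 - 3 * (13 / 10) + 1) ^ 4) (by norm_num) c)
      (hone (u := ((13 / 10) ^ 2 - 3 * (13 / 10) + 1) ^ 2) (by norm_num) k)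
    norm_num at h1 h3
    linarith
  have hc : c ≤ 4 := by
    by_contra! hc
    obtain ⟨k, rfl⟩ := Nat.exists_eq_add_of_lt hc
    have h1 := h (13 / 1000) (by norm_num) (by norm_num)
    have h2 : ∀ u v : ℝ, v ^ 2 ≤ 1 →
        u ^ 10 * v ^ 24 * (u ^ 2 * v ^ 4) ^ k ≤ (u ^ (4 + k + 1) * v ^ d) ^ 2 := fun u v hv => by
      calc u ^ 10 * v ^ 24 * (u ^ 2 * v ^ 4) ^ k
          = (u ^ (4 + k + 1)) ^ 2 * (v ^ 2) ^ (2 * (4 + k + 1) + 2) := by ring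
        _ ≤ (u ^ (4 + k + 1)) ^ 2 * (v ^ 2) ^ d :=
            mul_le_mul_of_nonneg_left (pow_le_pow_of_le_one (sq_nonneg v) hv hd) (sq_nonneg _)
        _ = (u ^ (4 + k + 1) * v ^ d) ^ 2 := by ring
    have h3 := h2 (13 / 1000 - 2) ((13 / 1000) ^ 2 - 3 * (13 / 1000) + 1) (by norm_num)
    have h4 := hone (u := (13 / 1000 - 2) ^ 2 * ((13 / 1000) ^ 2 - 3 * (13 / 1000) + 1) ^ 4)
      (by norm_num) k
    norm_num at h1 h3 h4
    linarith
  omega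

end IntegerPolynomials

section FreeSubgroup

open Matrix

/-- The homomorphism from the free group to `SL₂(ℂ)` with parameter `t`. -/
noncomputable def repHom {t b : ℂ} (hb : 4 * b ^ 2 = 3 - t ^ 2) :
    F →* Matrix.SpecialLinearGroup (Fin 2) ℂ :=
  FreeGroup.lift ![⟨repX, det_repX⟩, ⟨repY t b, det_repY hb⟩]

section

variable {t b : ℂ} (hb : 4 * b ^ 2 = 3 - t ^ 2)

lemma coe_repHom_x : (repHom hb x : Matrix (Fin 2) (Fin 2) ℂ) = repX := by
  simp [repHom, x]

lemma coe_repHom_y : (repHom hb y : Matrix (Fin 2) (Fin 2) ℂ) = repY t b := by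
  simp [repHom, y]

lemma coe_repHom_word (l : List ℕ) :
    (repHom hb (l.map fun k => x * y ^ k).prod : Matrix (Fin 2) (Fin 2) ℂ) =
      (l.map fun k => repX * repY t b ^ k).prod := by
  induction l with
  | nil => simp
  | cons k l ih =>
    simp only [List.map_cons, List.prod_cons, map_mul, Matrix.SpecialLinearGroup.coe_mul, ih,
      map_pow, Matrix.SpecialLinearGroup.coe_pow, coe_repHom_x, coe_repHom_y]

end

lemma neg_one_mem_center :
    (-1 : Matrix.SpecialLinearGroup (Fin 2) ℂ) ∈
      Subgroup.center (Matrix.SpecialLinearGroup (Fin 2) ℂ) :=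
  Subgroup.mem_center_iff.2 fun g => by simp

lemma sq_eq_one_of_mem_center {A : Matrix.SpecialLinearGroup (Fin 2) ℂ}
    (hA : A ∈ Subgroup.center (Matrix.SpecialLinearGroup (Fin 2) ℂ)) : A ^ 2 = 1 := by
  obtain ⟨r, hr, hrA⟩ := Matrix.SpecialLinearGroup.mem_center_iff.1 hA
  apply Subtype.ext
  rw [Matrix.SpecialLinearGroup.coe_pow, ← hrA, ← map_pow, show r ^ 2 = 1 by simpa using hr,
    map_one, Matrix.SpecialLinearGroup.coe_one]

lemma sq_eq_neg_one_of_trace {A : Matrix.SpecialLinearGroup (Fin 2) ℂ} (hA : A.1.trace = 0) :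
    A ^ 2 = -1 := by
  have hdet := A.2
  rw [det_fin_two] at hdet
  rw [trace_fin_two] at hA
  apply Subtype.ext
  ext i j
  fin_cases i <;> fin_cases j <;> simp [pow_two, mul_apply, Fin.sum_univ_two]
  · linear_combination A.1 0 0 * hA - hdet
  · linear_combination A.1 0 1 * hA
  · linear_combination A.1 1 0 * hA
  · linear_combination A.1 1 1 * hA - hdet

lemma repHom_mem_center {t b : ℂ} (hb : 4 * b ^ 2 = 3 - t ^ 2) {W w : F}
    (hW : (repHom hb W).1.trace = 0) (hw : mk W w = 1) :
    repHom hb w ∈ Subgroup.center (Matrix.SpecialLinearGroup (Fin 2) ℂ) := by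
  have h : Subgroup.normalClosure (rels W) ≤
      (Subgroup.center (Matrix.SpecialLinearGroup (Fin 2) ℂ)).comap (repHom hb) := by
    refine Subgroup.normalClosure_le_normal ?_
    rintro _ (rfl | rfl | rfl)
    · rw [SetLike.mem_coe, Subgroup.mem_comap, map_pow, sq_eq_neg_one_of_trace]
      · exact neg_one_mem_center
      · rw [coe_repHom_x, trace_repX]
    · rw [SetLike.mem_coe, Subgroup.mem_comap, map_pow]
      have hY := (traceRel_repX_repY hb).sq_right
      have h3 : repHom hb y ^ 3 = -1 := Subtype.ext <| by
        rw [Matrix.SpecialLinearGroup.coe_pow, coe_repHom_y, pow_succ', pow_two, hY, mul_sub, hY]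
        simp
      rw [h3]
      exact neg_one_mem_center
    · rw [SetLike.mem_coe, Subgroup.mem_comap, map_pow, sq_eq_neg_one_of_trace hW]
      exact neg_one_mem_center
  exact h ((QuotientGroup.eq_one_iff w).1 hw)

/-- A representation killing the relators up to sign, with two hyperbolic elements in general
position, yields a free subgroup of rank two. -/
lemma exists_free_subgroup {t b : ℂ} (hb : 4 * b ^ 2 = 3 - t ^ 2) {W : F}
    (hW : (repHom hb W).1.trace = 0) (g : Fin 2 → F)
    (hg : ∀ i, ∀ r : ℝ, |r| ≤ 2 → (repHom hb (g i)).1.trace ≠ r)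
    (hdet : ((repHom hb (g 0)).1 * (repHom hb (g 1)).1 -
      (repHom hb (g 1)).1 * (repHom hb (g 0)).1).det ≠ 0) :
    ∃ H : Subgroup (GT W), Nonempty (H ≃* FreeGroup (Fin 2)) := by
  obtain ⟨n, hn⟩ := exists_pow_lift_injective (fun i => repHom hb (g i)) hg hdet
  set ι : FreeGroup (Fin 2) →* F := FreeGroup.lift fun i => g i ^ n
  have hι : ∀ w, repHom hb (ι w) = FreeGroup.lift (fun i => repHom hb (g i) ^ n) w := fun w => by
    rw [← MonoidHom.comp_apply]
    congr 1
    ext i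
    simp [ι]
  have hψ : Function.Injective ((mk W).comp ι) := by
    refine (injective_iff_map_eq_one _).2 fun w hw => ?_
    have h := sq_eq_one_of_mem_center (repHom_mem_center hb hW hw)
    rw [hι, ← map_pow] at h
    exact sq_eq_one.mp (hn (h.trans (map_one _).symm))
  exact ⟨((mk W).comp ι).range, ⟨(MonoidHom.ofInjective hψ).symm⟩⟩

/-- Without free subgroups of rank two, the roots of the trace polynomial lie in `[0, 3]`. -/
lemma OddForm.root_mem {l : List ℕ} {m : ℕ} {p q r e : ℤ[X]} (h : OddForm l m p q r e)
    (hfree : ¬ ∃ H : Subgroup (GT (l.map fun k => x * y ^ k).prod),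
      Nonempty (H ≃* FreeGroup (Fin 2)))
    (z : ℂ) (hz : aeval z (oddTracePoly p r e) = 0) : ∃ s : ℝ, z = s ∧ 0 ≤ s ∧ s ≤ 3 := by
  by_contra hs
  obtain ⟨t, rfl⟩ := IsAlgClosed.exists_pow_nat_eq z two_pos
  obtain ⟨b, hb⟩ := IsAlgClosed.exists_pow_nat_eq ((3 - t ^ 2) / 4) two_pos
  replace hb : 4 * b ^ 2 = 3 - t ^ 2 := by rw [hb]; ring
  have hW : (repHom hb (l.map fun k => x * y ^ k).prod).1.trace = 0 := by
    rw [coe_repHom_word, h.trace_eq (traceRel_repX_repY hb) trace_repX (trace_repY t b)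
      (trace_repX_mul_repY t b), hz, mul_zero]
  by_cases ht : ∃ r : ℝ, |r| ≤ 2 ∧ t = r
  · obtain ⟨r, hr, rfl⟩ := ht
    have hr3 : 3 < r ^ 2 := by
      by_contra! hr3
      exact hs ⟨r ^ 2, by push_cast; rfl, sq_nonneg r, hr3⟩
    have htr : ∀ u : ℝ, |u| ≤ 2 → ((r : ℂ) ^ 2 - 1) ≠ u := fun u hu hru => by
      have : r ^ 2 - 1 = u := by exact_mod_cast hru
      linarith [(abs_le.1 hu).2]
    refine hfree (exists_free_subgroup hb hW
      ![x * y * (x * y ^ 2), x * y ^ 2 * (x * y)] (fun i => ?_) ?_)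
    · fin_cases i
      · simpa [coe_repHom_x, coe_repHom_y, trace_commutator_words hb] using htr
      · simpa [coe_repHom_x, coe_repHom_y, trace_mul_comm (repX * repY r b ^ 2),
          trace_commutator_words hb] using htr
    · simp only [cons_val_zero, cons_val_one, map_mul, map_pow, Matrix.SpecialLinearGroup.coe_mul,
        Matrix.SpecialLinearGroup.coe_pow, coe_repHom_x, coe_repHom_y, det_commutator_mul hb]
      have : (r ^ 3 - 3 * r) ^ 2 ≠ 0 := by
        rw [show (r ^ 3 - 3 * r) ^ 2 = r ^ 2 * (r ^ 2 - 3) ^ 2 by ring]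
        exact (mul_pos (by linarith) (pow_pos (by linarith) 2)).ne'
      exact_mod_cast this
  · have htr : ∀ u : ℝ, |u| ≤ 2 → t ≠ u := fun u hu htu => ht ⟨u, hu, htu⟩
    refine hfree (exists_free_subgroup hb hW ![x * y, x * y ^ 2] (fun i => ?_) ?_)
    · fin_cases i
      · simpa [coe_repHom_x, coe_repHom_y, trace_repX_mul_repY] using htr
      · simpa [coe_repHom_x, coe_repHom_y, trace_repX_mul_repY_sq hb] using htr
    · simp only [cons_val_zero, cons_val_one, map_mul, map_pow, Matrix.SpecialLinearGroup.coe_mul,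
        Matrix.SpecialLinearGroup.coe_pow, coe_repHom_x, coe_repHom_y, det_commutator hb]
      exact fun h3 => hs ⟨3, by push_cast; linear_combination -h3, by norm_num, le_rfl⟩

end FreeSubgroup

end

theorem stmt_3 (ℓ : ℕ) (hℓ : 1 ≤ ℓ) (hodd : Odd ℓ) (α : Fin ℓ → ℕ)
    (hα : ∀ i, α i = 1 ∨ α i = 2)
    (hsum : (∑ i, α i) % 3 ≠ 0)
    (W : F) (hW : W = (List.ofFn fun i => x * y ^ (α i)).prod)
    (hfree : ¬ ∃ H : Subgroup (GT W), Nonempty (H ≃* FreeGroup (Fin 2))) :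
    ℓ ≤ 49 := by
  obtain ⟨m, rfl⟩ := hodd
  set l := List.ofFn α with hl
  have hlen : l.length = 2 * m + 1 := List.length_ofFn
  have hWl : W = (l.map fun k => x * y ^ k).prod := by
    rw [hW, hl, List.map_ofFn]
    rfl
  subst hWl
  obtain ⟨p, q, r, e, h⟩ := exists_oddForm m l hlen fun k hk => by
    obtain ⟨i, rfl⟩ := (List.mem_ofFn' _ _).1 hk
    exact hα i
  obtain ⟨c, d, hcd⟩ := exists_eq_pow_mul_pow m (oddTracePoly p r e) h.natDegree_eq h.monic
    (h.root_mem hfree) (by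
      have h3 := h.aeval_three_sq hlen (by rwa [hl, List.sum_ofFn])
      have h3' : (Polynomial.aeval (algebraMap ℤ ℂ 3) (oddTracePoly p r e) : ℂ) ^ 2 = 1 := by
        simpa using h3
      rw [Polynomial.aeval_algebraMap_apply_eq_algebraMap_eval, eq_intCast] at h3'
      exact_mod_cast h3')
  have hdeg := h.natDegree_eq
  rw [hcd, ((Polynomial.monic_X_sub_C 2).pow c).natDegree_mul (golden_monic.pow d),
    (Polynomial.monic_X_sub_C 2).natDegree_pow, golden_monic.natDegree_pow, golden_natDegree,
    Polynomial.natDegree_X_sub_C] at hdeg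
  have hbound := exponent_bound (c := c) (d := d) fun s h0 h3 => by
    have := h.eval_sq_le h0 h3
    rw [hcd] at this
    simpa [map_ofNat] using this
  omega
end

section
/- Let c and e be nonnegative integers such that for every real number z with |z| ≤ √3 one has |z (z² − 2)^c (z⁴ − 3z² + 1)^e| ≤ 2. Then c ≤ 4 and e ≤ 2c + 2; in particular 1 + 2c + 4e ≤ 49. -/
/-- A polynomial bound at a point `z` of `[-√3, √3]`, with the absolute values distributed. -/
theorem abs_bound_of_sq_le_three {c e : ℕ}
    (h : ∀ z : ℝ, |z| ≤ Real.sqrt 3 →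
      |z * (z ^ 2 - 2) ^ c * (z ^ 4 - 3 * z ^ 2 + 1) ^ e| ≤ 2) {z : ℝ} (hz : z ^ 2 ≤ 3) :
    |z| * |z ^ 2 - 2| ^ c * |z ^ 4 - 3 * z ^ 2 + 1| ^ e ≤ 2 := by
  simpa only [abs_mul, abs_pow] using h z (Real.abs_le_sqrt hz)

theorem le_two_mul_add_two_of_bound {c e : ℕ}
    (h : ∀ z : ℝ, |z| ≤ Real.sqrt 3 →
      |z * (z ^ 2 - 2) ^ c * (z ^ 4 - 3 * z ^ 2 + 1) ^ e| ≤ 2) : e ≤ 2 * c + 2 := by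
  by_contra! he
  rcases Nat.lt_or_ge c 2 with hc | hc
  · have hb := abs_bound_of_sq_le_three h (z := 1.18) (by norm_num)
    have hq : |(1.18 : ℝ) ^ 4 - 3 * 1.18 ^ 2 + 1| ^ (2 * c + 3) ≤
        |(1.18 : ℝ) ^ 4 - 3 * 1.18 ^ 2 + 1| ^ e :=
      pow_le_pow_right₀ (by norm_num [abs_of_neg]) he
    have hb' := (mul_le_mul_of_nonneg_left hq
      (by positivity : 0 ≤ |(1.18 : ℝ)| * |(1.18 : ℝ) ^ 2 - 2| ^ c)).trans hb
    interval_cases c <;> norm_num [abs_of_neg, abs_of_pos] at hb'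
  · have hb := abs_bound_of_sq_le_three h (z := 1.12) (by norm_num)
    have hq : |(1.12 : ℝ) ^ 4 - 3 * 1.12 ^ 2 + 1| ^ (2 * c + 3) ≤
        |(1.12 : ℝ) ^ 4 - 3 * 1.12 ^ 2 + 1| ^ e :=
      pow_le_pow_right₀ (by norm_num [abs_of_neg]) he
    have hb' := (mul_le_mul_of_nonneg_left hq
      (by positivity : 0 ≤ |(1.12 : ℝ)| * |(1.12 : ℝ) ^ 2 - 2| ^ c)).trans hb
    have hp : (1.05 : ℝ) ^ 2 ≤
        (|(1.12 : ℝ) ^ 2 - 2| * |(1.12 : ℝ) ^ 4 - 3 * 1.12 ^ 2 + 1| ^ 2) ^ c :=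
      (pow_le_pow_right₀ (by norm_num) hc).trans
        (pow_le_pow_left₀ (by norm_num) (by norm_num [abs_of_neg]) c)
    have hk : (1.88 : ℝ) ≤ |(1.12 : ℝ)| * |(1.12 : ℝ) ^ 4 - 3 * 1.12 ^ 2 + 1| ^ 3 := by
      norm_num [abs_of_neg, abs_of_pos]
    have hm := mul_le_mul hk hp (by norm_num) (by positivity)
    rw [mul_pow, ← pow_mul] at hm
    rw [pow_add] at hb'
    norm_num only at hm hb'
    linarith

theorem le_four_of_bound {c e : ℕ}
    (h : ∀ z : ℝ, |z| ≤ Real.sqrt 3 →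
      |z * (z ^ 2 - 2) ^ c * (z ^ 4 - 3 * z ^ 2 + 1) ^ e| ≤ 2)
    (he : e ≤ 2 * c + 2) : c ≤ 4 := by
  by_contra! hc
  have hb := abs_bound_of_sq_le_three h (z := 0.14) (by norm_num)
  have hq : |(0.14 : ℝ) ^ 4 - 3 * 0.14 ^ 2 + 1| ^ (2 * c + 2) ≤
      |(0.14 : ℝ) ^ 4 - 3 * 0.14 ^ 2 + 1| ^ e :=
    pow_le_pow_of_le_one (abs_nonneg _) (by norm_num [abs_of_pos]) he
  have hb' := (mul_le_mul_of_nonneg_left hq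
    (by positivity : 0 ≤ |(0.14 : ℝ)| * |(0.14 : ℝ) ^ 2 - 2| ^ c)).trans hb
  have hp : (1.755 : ℝ) ^ 5 ≤
      (|(0.14 : ℝ) ^ 2 - 2| * |(0.14 : ℝ) ^ 4 - 3 * 0.14 ^ 2 + 1| ^ 2) ^ c :=
    (pow_le_pow_right₀ (by norm_num) hc).trans
      (pow_le_pow_left₀ (by norm_num) (by norm_num [abs_of_neg, abs_of_pos]) c)
  have hk : (0.124 : ℝ) ≤ |(0.14 : ℝ)| * |(0.14 : ℝ) ^ 4 - 3 * 0.14 ^ 2 + 1| ^ 2 := by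
    norm_num [abs_of_pos]
  have hm := mul_le_mul hk hp (by norm_num) (by positivity)
  rw [mul_pow, ← pow_mul] at hm
  rw [pow_add] at hb'
  norm_num only at hm hb'
  linarith

theorem stmt_4 (c e : ℕ)
    (h : ∀ z : ℝ, |z| ≤ Real.sqrt 3 →
      |z * (z ^ 2 - 2) ^ c * (z ^ 4 - 3 * z ^ 2 + 1) ^ e| ≤ 2) :
    c ≤ 4 ∧ e ≤ 2 * c + 2 ∧ 1 + 2 * c + 4 * e ≤ 49 := by
  have he := le_two_mul_add_two_of_bound h
  have hc := le_four_of_bound h he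
  exact ⟨hc, he, by lia⟩
end

section
/- For every real number z with |z| ≤ √3 there exist matrices X, Y ∈ SU(2) (2×2 complex unitary matrices of determinant 1) with trace(X) = 0, trace(Y) = 1 and trace(XY) = z. Consequently, for any such z and any matrices X, Y so chosen, every product of copies of X, Y and their inverses has real trace lying in the interval [−2, 2]. -/
/-- A 2×2 complex unitary matrix of determinant 1, i.e. an element of SU(2). -/
def IsSU2 (X : Matrix.unitaryGroup (Fin 2) ℂ) : Prop :=
  Matrix.det (X : Matrix (Fin 2) (Fin 2) ℂ) = 1

open Matrix in
/-- A `2 × 2` special unitary matrix has real trace in `[-2, 2]`. -/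
lemma IsSU2.exists_trace_eq {U : Matrix.unitaryGroup (Fin 2) ℂ} (hU : IsSU2 U) :
    ∃ t : ℝ, Matrix.trace (U : Matrix (Fin 2) (Fin 2) ℂ) = (t : ℂ) ∧ t ∈ Set.Icc (-2 : ℝ) 2 := by
  have hdet : (U : Matrix (Fin 2) (Fin 2) ℂ).det = 1 := hU
  have hadj : star (U : Matrix (Fin 2) (Fin 2) ℂ) = adjugate (U : Matrix (Fin 2) (Fin 2) ℂ) :=
    calc star (U : Matrix (Fin 2) (Fin 2) ℂ)
        = star (U : Matrix (Fin 2) (Fin 2) ℂ) * (U * adjugate (U : Matrix (Fin 2) (Fin 2) ℂ)) := by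
          rw [mul_adjugate, hdet, one_smul, mul_one]
      _ = adjugate (U : Matrix (Fin 2) (Fin 2) ℂ) := by
          rw [← mul_assoc, Unitary.coe_star_mul_self, one_mul]
  have hdiag : (starRingEnd ℂ) (U.1 0 0) = U.1 1 1 := by
    have h := congrFun (congrFun hadj 0) 0
    simpa [adjugate_fin_two, star_apply] using h
  have habs := (Complex.abs_re_le_norm (U.1 0 0)).trans (entry_norm_bound_of_unitary U.2 0 0)
  rw [abs_le] at habs
  refine ⟨2 * (U.1 0 0).re, ?_, by linarith, by linarith⟩
  rw [trace_fin_two, ← hdiag, Complex.add_conj]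

/-- A subgroup of the unitary group generated by special unitary matrices consists of such. -/
lemma IsSU2.of_mem_closure {S : Set (Matrix.unitaryGroup (Fin 2) ℂ)} (hS : ∀ U ∈ S, IsSU2 U)
    {g : Matrix.unitaryGroup (Fin 2) ℂ} (hg : g ∈ Subgroup.closure S) : IsSU2 g := by
  let f : Matrix.unitaryGroup (Fin 2) ℂ →* ℂ :=
    Matrix.detMonoidHom.comp (Matrix.unitaryGroup (Fin 2) ℂ).subtype
  exact (Subgroup.closure_le f.ker).2 (fun U hU => hS U hU) hg

open Matrix ComplexConjugate in
/-- The matrix `!![a, b; -conj b, conj a]` with `|a|² + |b|² = 1` is unitary. -/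
lemma Matrix.mem_unitaryGroup_fin_two_of_normSq {a b : ℂ}
    (h : Complex.normSq a + Complex.normSq b = 1) :
    !![a, b; -conj b, conj a] ∈ unitaryGroup (Fin 2) ℂ := by
  have h' : a * conj a + b * conj b = 1 := by
    rw [Complex.mul_conj, Complex.mul_conj]
    exact_mod_cast h
  rw [mem_unitaryGroup_iff]
  ext i j
  fin_cases i <;> fin_cases j <;> simp [mul_apply, star_apply] <;>
    first | ring1 | linear_combination h'

theorem stmt_5 :
    (∀ z : ℝ, |z| ≤ Real.sqrt 3 →
      ∃ X Y : Matrix.unitaryGroup (Fin 2) ℂ, IsSU2 X ∧ IsSU2 Y ∧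
        Matrix.trace (X : Matrix (Fin 2) (Fin 2) ℂ) = 0 ∧
        Matrix.trace (Y : Matrix (Fin 2) (Fin 2) ℂ) = 1 ∧
        Matrix.trace ((X * Y : Matrix.unitaryGroup (Fin 2) ℂ) :
          Matrix (Fin 2) (Fin 2) ℂ) = (z : ℂ)) ∧
    (∀ z : ℝ, |z| ≤ Real.sqrt 3 →
      ∀ X Y : Matrix.unitaryGroup (Fin 2) ℂ, IsSU2 X → IsSU2 Y →
        Matrix.trace (X : Matrix (Fin 2) (Fin 2) ℂ) = 0 →
        Matrix.trace (Y : Matrix (Fin 2) (Fin 2) ℂ) = 1 →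
        Matrix.trace ((X * Y : Matrix.unitaryGroup (Fin 2) ℂ) :
          Matrix (Fin 2) (Fin 2) ℂ) = (z : ℂ) →
        ∀ g ∈ Subgroup.closure {X, Y},
          ∃ t : ℝ, Matrix.trace ((g : Matrix.unitaryGroup (Fin 2) ℂ) :
              Matrix (Fin 2) (Fin 2) ℂ) = (t : ℂ) ∧ t ∈ Set.Icc (-2 : ℝ) 2) := by
  refine ⟨fun z hz => ?_, fun z _ X Y hX hY _ _ _ g hg =>
    (IsSU2.of_mem_closure (by simp [hX, hY]) hg).exists_trace_eq⟩
  have hz2 : z ^ 2 ≤ 3 := by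
    rw [← sq_abs]
    exact (Real.le_sqrt (abs_nonneg z) (by norm_num)).1 hz
  have hs : √(3 - z ^ 2) ^ 2 = 3 - z ^ 2 := Real.sq_sqrt (by linarith)
  have hX : Complex.normSq Complex.I + Complex.normSq 0 = 1 := by simp
  have hY : Complex.normSq ⟨1 / 2, -z / 2⟩ + Complex.normSq ⟨√(3 - z ^ 2) / 2, 0⟩ = 1 := by
    simp only [Complex.normSq_mk]
    linear_combination hs / 4
  refine ⟨⟨_, Matrix.mem_unitaryGroup_fin_two_of_normSq hX⟩,
    ⟨_, Matrix.mem_unitaryGroup_fin_two_of_normSq hY⟩, ?_, ?_, ?_, ?_, ?_⟩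
  · simp [IsSU2, Matrix.det_fin_two]
  · simp only [IsSU2, Matrix.det_fin_two_of, mul_neg, sub_neg_eq_add, Complex.mul_conj]
    exact_mod_cast hY
  · simp [Matrix.trace_fin_two]
  · apply Complex.ext <;> simp [Matrix.trace_fin_two] <;> norm_num
  · apply Complex.ext <;> simp [Matrix.trace_fin_two] <;> ring
end
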